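/- For Re(b) > 0, Re(s) > 0, and Re(c - a - b) > 0, the Laplace transform ∫₀^∞ e^{-st} t^{b-1} ₁F₁(a; c; st) dt equals Γ(b) s^{-b} ₂F₁(a, b; c; 1), where the latter is the (absolutely convergent) Gauss hypergeometric series at 1. -/

import Mathlib

open Complex Set MeasureTheory

/-- Pochhammer symbol `(a)_n` on the complex numbers. -/
noncomputable def poch (a : ℂ) (n : ℕ) : ℂ := (ascPochhammer ℂ n).eval a

/-- Generalized hypergeometric series with numerator parameters `as` and
denominator parameters `bs`, evaluated at `z`. -/
noncomputable def hyp (as bs : List ℂ) (z : ℂ) : ℂ :=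
  ∑' n : ℕ, ((as.map fun a => poch a n).prod /
    ((bs.map fun b => poch b n).prod * (n.factorial : ℂ))) * z ^ n

open Filter Topology

/-! ### The Laplace transform of a power -/

lemma norm_exp_mul_cpow (b s : ℂ) {t : ℝ} (ht : 0 < t) :
    ‖exp (-(s * t)) * (t : ℂ) ^ (b - 1)‖ = t ^ (b.re - 1) * Real.exp (-(s.re * t)) := by
  rw [norm_mul, norm_cpow_eq_rpow_re_of_pos ht, norm_exp, mul_comm]
  simp

lemma aestronglyMeasurable_exp_mul_cpow (b s : ℂ) :
    AEStronglyMeasurable (fun t : ℝ => exp (-(s * t)) * (t : ℂ) ^ (b - 1))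
      (volume.restrict (Ioi 0)) :=
  Measurable.aestronglyMeasurable (by fun_prop)

lemma integrableOn_rpow_mul_exp_neg {r σ : ℝ} (hr : 0 < r) (hσ : 0 < σ) :
    IntegrableOn (fun t : ℝ => t ^ (r - 1) * Real.exp (-(σ * t))) (Ioi 0) := by
  simpa using integrableOn_rpow_mul_exp_neg_mul_rpow (s := r - 1) (by linarith) one_pos hσ

lemma integrableOn_exp_mul_cpow {b s : ℂ} (hb : 0 < b.re) (hs : 0 < s.re) :
    IntegrableOn (fun t : ℝ => exp (-(s * t)) * (t : ℂ) ^ (b - 1)) (Ioi 0) := by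
  refine (integrableOn_rpow_mul_exp_neg hb hs).mono' (aestronglyMeasurable_exp_mul_cpow b s) ?_
  filter_upwards [ae_restrict_mem measurableSet_Ioi] with t ht
  exact (norm_exp_mul_cpow b s ht).le

lemma differentiableAt_laplace_cpow {b s : ℂ} (hb : 0 < b.re) (hs : 0 < s.re) :
    DifferentiableAt ℂ (fun s : ℂ => ∫ t in Ioi (0:ℝ), exp (-(s * t)) * (t : ℂ) ^ (b - 1)) s := by
  refine (hasDerivAt_integral_of_dominated_loc_of_deriv_le
    (s := {z : ℂ | s.re / 2 < z.re})
    (F' := fun z t => exp (-(z * t)) * -(t : ℂ) * (t : ℂ) ^ (b - 1))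
    (bound := fun t => t ^ ((b.re + 1) - 1) * Real.exp (-(s.re / 2 * t)))
    ?_ (.of_forall fun z => aestronglyMeasurable_exp_mul_cpow b z)
    (integrableOn_exp_mul_cpow hb hs) (Measurable.aestronglyMeasurable (by fun_prop)) ?_
    (integrableOn_rpow_mul_exp_neg (by linarith) (by linarith)) ?_).2.differentiableAt
  · exact (isOpen_lt continuous_const continuous_re).mem_nhds (by simp; linarith)
  · filter_upwards [ae_restrict_mem measurableSet_Ioi] with t ht z hz
    have ht' : 0 < t := ht
    rw [mul_right_comm, norm_mul, norm_exp_mul_cpow b z ht, norm_neg, norm_real,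
      Real.norm_of_nonneg ht'.le, mul_right_comm, ← Real.rpow_add_one ht'.ne',
      show b.re - 1 + 1 = b.re + 1 - 1 by ring]
    have : s.re / 2 < z.re := hz
    gcongr
  · refine ae_of_all _ fun t z _ => HasDerivAt.mul_const ?_ _
    have h : HasDerivAt (fun z : ℂ => -(z * t)) (-(t : ℂ)) z := by
      simpa using ((hasDerivAt_id z).mul_const (t : ℂ)).fun_neg
    exact h.cexp

lemma laplace_cpow {b s : ℂ} (hb : 0 < b.re) (hs : 0 < s.re) :
    ∫ t in Ioi (0:ℝ), exp (-(s * t)) * (t : ℂ) ^ (b - 1) = Gamma b * s ^ (-b) := by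
  have hopen : IsOpen {z : ℂ | 0 < z.re} := isOpen_lt continuous_const continuous_re
  have hf : AnalyticOnNhd ℂ
      (fun s : ℂ => ∫ t in Ioi (0:ℝ), exp (-(s * t)) * (t : ℂ) ^ (b - 1)) {z | 0 < z.re} :=
    DifferentiableOn.analyticOnNhd
      (fun z hz => (differentiableAt_laplace_cpow hb hz).differentiableWithinAt) hopen
  have hg : AnalyticOnNhd ℂ (fun s : ℂ => Gamma b * s ^ (-b)) {z | 0 < z.re} := by
    refine DifferentiableOn.analyticOnNhd (fun z hz => ?_) hopen
    exact ((differentiableAt_id.cpow_const (Or.inl hz)).const_mul _).differentiableWithinAt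
  refine hf.eqOn_of_preconnected_of_frequently_eq hg
    (convex_halfSpace_re_gt 0).isPreconnected (z₀ := 1) (by simp) ?_ hs
  have hreal : ∃ᶠ x : ℝ in 𝓝[≠] 1,
      ∫ t in Ioi (0:ℝ), exp (-((x : ℂ) * t)) * (t : ℂ) ^ (b - 1) = Gamma b * (x : ℂ) ^ (-b) := by
    refine Eventually.frequently ?_
    filter_upwards [nhdsWithin_le_nhds (Ioi_mem_nhds one_pos)] with x hx
    have h := integral_cpow_mul_exp_neg_mul_Ioi hb hx
    simp_rw [mul_comm (exp _)]
    rw [h, one_div, inv_cpow_ofReal_nonneg (le_of_lt hx), cpow_neg, mul_comm]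
  have ht : Tendsto (fun x : ℝ => (x : ℂ)) (𝓝[≠] 1) (𝓝[≠] 1) := by
    refine tendsto_nhdsWithin_of_tendsto_nhds_of_eventually_within _ ?_ ?_
    · exact (continuous_ofReal.tendsto' 1 1 (by simp)).mono_left nhdsWithin_le_nhds
    · filter_upwards [self_mem_nhdsWithin] with x hx
      simpa using hx
  exact ht.frequently hreal

/-! ### The Beta weight -/

/-- The integrand of Euler's Beta integral. -/
noncomputable def betaWeight (a α : ℂ) (u : ℝ) : ℂ :=
  (u : ℂ) ^ (a - 1) * (1 - (u : ℂ)) ^ (α - 1)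

lemma measurable_betaWeight (a α : ℂ) : Measurable (betaWeight a α) := by
  unfold betaWeight
  fun_prop

lemma integrableOn_betaWeight {a α : ℂ} (ha : 0 < a.re) (hα : 0 < α.re) :
    IntegrableOn (betaWeight a α) (Ioo 0 1) := by
  have h := betaIntegral_convergent ha hα
  rw [intervalIntegrable_iff_integrableOn_Ioo_of_le zero_le_one] at h
  exact h

lemma integral_betaWeight (a α : ℂ) : ∫ u in Ioo (0:ℝ) 1, betaWeight a α u = betaIntegral a α := by
  rw [betaIntegral, intervalIntegral.integral_of_le zero_le_one, integral_Ioc_eq_integral_Ioo]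
  rfl

lemma pow_mul_betaWeight (a α : ℂ) (n : ℕ) {u : ℝ} (hu : 0 < u) :
    (u : ℂ) ^ n * betaWeight a α u = betaWeight (a + n) α u := by
  rw [betaWeight, betaWeight, ← mul_assoc, ← cpow_natCast, ← cpow_add _ _ (by simpa using hu.ne')]
  ring_nf

lemma cpow_neg_mul_betaWeight (a α b : ℂ) {u : ℝ} (hu : u < 1) :
    (1 - (u : ℂ)) ^ (-b) * betaWeight a α u = betaWeight a (α - b) u := by
  have h : (1 - (u : ℂ)) ≠ 0 := by
    exact_mod_cast (sub_pos.2 hu).ne'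
  rw [betaWeight, betaWeight, mul_left_comm, ← cpow_add _ _ h]
  ring_nf

lemma rpow_neg_mul_norm_betaWeight (a α b : ℂ) {u : ℝ} (hu : u < 1) :
    (1 - u) ^ (-b.re) * ‖betaWeight a α u‖ = ‖betaWeight a (α - b) u‖ := by
  rw [← cpow_neg_mul_betaWeight a α b hu, norm_mul, ← ofReal_one, ← ofReal_sub,
    norm_cpow_eq_rpow_re_of_pos (sub_pos.2 hu), neg_re]

lemma ne_neg_natCast_of_re_pos {z : ℂ} (hz : 0 < z.re) (n : ℕ) : z ≠ -(n : ℂ) := by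
  rintro rfl
  simp at hz
  exact absurd hz (by simp)

lemma poch_eq_Gamma {z : ℂ} (hz : 0 < z.re) (n : ℕ) : poch z n = Gamma (z + n) / Gamma z :=
  (Gamma_add_nat_div_Gamma_eq z (ne_neg_natCast_of_re_pos hz)).symm

lemma betaIntegral_eq_div {a α : ℂ} (ha : 0 < a.re) (hα : 0 < α.re) :
    betaIntegral a α = Gamma a * Gamma α / Gamma (a + α) := by
  rw [Gamma_mul_Gamma_eq_betaIntegral ha hα, mul_div_cancel_left₀]
  exact Gamma_ne_zero_of_re_pos (by simp; linarith)

lemma integral_pow_mul_betaWeight {a α : ℂ} (ha : 0 < a.re) (hα : 0 < α.re) (n : ℕ) :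
    ∫ u in Ioo (0:ℝ) 1, (u : ℂ) ^ n * betaWeight a α u =
      betaIntegral a α * (poch a n / poch (a + α) n) := by
  have haα : 0 < (a + α).re := by simp; linarith
  have han : 0 < (a + n).re := by simp; positivity
  have hn : 0 < (a + α + n).re := by simp; positivity
  rw [setIntegral_congr_fun measurableSet_Ioo (fun u hu => pow_mul_betaWeight a α n hu.1),
    integral_betaWeight, betaIntegral_eq_div han hα, betaIntegral_eq_div ha hα,
    poch_eq_Gamma ha, poch_eq_Gamma haα, add_right_comm a (n : ℂ) α]
  have h1 := Gamma_ne_zero_of_re_pos ha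
  have h2 := Gamma_ne_zero_of_re_pos haα
  have h3 := Gamma_ne_zero_of_re_pos hn
  field_simp

/-! ### Hypergeometric coefficients and their Euler integrals -/

/-- The coefficients of Kummer's series `₁F₁(a; c; ·)`. -/
noncomputable def kummerCoeff (a c : ℂ) (n : ℕ) : ℂ := poch a n / (poch c n * (n.factorial : ℂ))

lemma hyp_kummer (a c z : ℂ) : hyp [a] [c] z = ∑' n, kummerCoeff a c n * z ^ n := by
  simp [hyp, kummerCoeff]

lemma hyp_gauss_one (a b c : ℂ) : hyp [a, b] [c] 1 = ∑' n, kummerCoeff a c n * poch b n := by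
  simp [hyp, kummerCoeff, div_mul_eq_mul_div]

lemma hasSum_kummerCoeff_mul {a α : ℂ} (ha : 0 < a.re) (hα : 0 < α.re) {x : ℕ → ℂ} {q : ℕ → ℝ}
    {g : ℝ → ℂ} {G : ℝ → ℝ} (hxq : ∀ n, ‖x n‖ ≤ q n)
    (hg : ∀ u ∈ Ioo (0:ℝ) 1, HasSum (fun n => x n / n.factorial * (u : ℂ) ^ n) (g u))
    (hG : ∀ u ∈ Ioo (0:ℝ) 1, HasSum (fun n => q n / n.factorial * u ^ n) (G u))
    (hint : IntegrableOn (fun u => G u * ‖betaWeight a α u‖) (Ioo 0 1)) :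
    HasSum (fun n => betaIntegral a α * (kummerCoeff a (a + α) n * x n))
      (∫ u in Ioo (0:ℝ) 1, g u * betaWeight a α u) := by
  have hmain := hasSum_integral_of_dominated_convergence (μ := volume.restrict (Ioo (0:ℝ) 1))
    (F := fun n u => x n / n.factorial * (u : ℂ) ^ n * betaWeight a α u)
    (f := fun u => g u * betaWeight a α u)
    (fun n u => q n / n.factorial * u ^ n * ‖betaWeight a α u‖)
    (fun n => (Measurable.mul (by fun_prop) (measurable_betaWeight a α)).aestronglyMeasurable)
    ?_ ?_ ?_ ?_
  · refine (congrArg (HasSum · _) (funext fun n => ?_)).mpr hmain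
    simp_rw [mul_assoc]
    rw [integral_const_mul, integral_pow_mul_betaWeight ha hα, kummerCoeff]
    ring
  · intro n
    filter_upwards [ae_restrict_mem measurableSet_Ioo] with u hu
    simp only [norm_mul, norm_div, norm_pow, norm_real, Real.norm_of_nonneg hu.1.le, Complex.norm_natCast]
    have := hu.1.le
    have := hxq n
    have := (norm_nonneg (x n)).trans this
    gcongr
  · filter_upwards [ae_restrict_mem measurableSet_Ioo] with u hu
    exact ((hG u hu).mul_right _).summable
  · refine hint.congr_fun (fun u hu => ?_) measurableSet_Ioo
    exact ((hG u hu).mul_right _).tsum_eq.symm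
  · filter_upwards [ae_restrict_mem measurableSet_Ioo] with u hu
    exact (hg u hu).mul_right _

lemma hasSum_kummer {a α : ℂ} (ha : 0 < a.re) (hα : 0 < α.re) (z : ℂ) :
    HasSum (fun n => betaIntegral a α * (kummerCoeff a (a + α) n * z ^ n))
      (∫ u in Ioo (0:ℝ) 1, exp (z * u) * betaWeight a α u) := by
  refine hasSum_kummerCoeff_mul (q := fun n => ‖z‖ ^ n) (G := fun u => Real.exp (‖z‖ * u)) ha hα
    (fun n => (norm_pow z n).le) (fun u _ => ?_) (fun u _ => ?_) ?_
  · have h := NormedSpace.expSeries_div_hasSum_exp (z * (u : ℂ))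
    rw [← Complex.exp_eq_exp_ℂ] at h
    simpa only [mul_pow, div_mul_eq_mul_div] using h
  · have h := NormedSpace.expSeries_div_hasSum_exp (‖z‖ * u)
    rw [← Real.exp_eq_exp_ℝ] at h
    simpa only [mul_pow, div_mul_eq_mul_div] using h
  · refine ((integrableOn_betaWeight ha hα).norm.const_mul (Real.exp ‖z‖)).mono'
      (Measurable.aestronglyMeasurable
        (Measurable.mul (by fun_prop) (measurable_betaWeight a α).norm)) ?_
    filter_upwards [ae_restrict_mem measurableSet_Ioo] with u hu
    rw [norm_mul, norm_norm, Real.norm_of_nonneg (Real.exp_pos _).le]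
    have : ‖z‖ * u ≤ ‖z‖ := mul_le_of_le_one_right (norm_nonneg z) hu.2.le
    gcongr

lemma hasSum_poch_div_factorial (b : ℂ) {u : ℝ} (hu : u ∈ Ioo (0:ℝ) 1) :
    HasSum (fun n : ℕ => poch b n / n.factorial * (u : ℂ) ^ n) ((1 - (u : ℂ)) ^ (-b)) := by
  have h := (one_div_one_sub_cpow_hasFPowerSeriesOnBall_zero b).hasSum (y := (u : ℂ)) (by
    rw [← ENNReal.ofReal_one, Metric.eball_ofReal]
    simpa [abs_of_pos hu.1] using hu.2)
  rw [zero_add, one_div, ← cpow_neg] at h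
  have hch : ∀ n : ℕ, Ring.choose (b + n - 1) n = poch b n / n.factorial := fun n => by
    rw [← Ring.multichoose_eq, eq_div_iff (by exact_mod_cast n.factorial_ne_zero), mul_comm,
      ← nsmul_eq_mul, Ring.factorial_nsmul_multichoose_eq_ascPochhammer,
      Polynomial.ascPochhammer_smeval_eq_eval, poch]
  simpa only [FormalMultilinearSeries.ofScalars_apply_eq, hch, smul_eq_mul] using h

lemma poch_ofReal (r : ℝ) (n : ℕ) : poch r n = (((ascPochhammer ℝ n).eval r : ℝ) : ℂ) := by
  rw [poch, ← ascPochhammer_map (algebraMap ℝ ℂ), Polynomial.eval_map_algebraMap]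
  exact Polynomial.aeval_algebraMap_apply_eq_algebraMap_eval _ _

lemma norm_Gamma_le {z : ℂ} (hz : 0 < z.re) : ‖Gamma z‖ ≤ Real.Gamma z.re := by
  rw [Gamma_eq_integral hz, Real.Gamma_eq_integral hz]
  refine (norm_integral_le_integral_norm _).trans_eq
    (setIntegral_congr_fun measurableSet_Ioi fun t ht => ?_)
  have ht' : 0 < t := ht
  simp [norm_cpow_eq_rpow_re_of_pos ht', Complex.norm_exp]

lemma norm_poch_le {b : ℂ} (hb : 0 < b.re) (n : ℕ) :
    ‖poch b n‖ ≤ Real.Gamma b.re / ‖Gamma b‖ * (ascPochhammer ℝ n).eval b.re := by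
  have hr : (ascPochhammer ℝ n).eval b.re = Real.Gamma (b.re + n) / Real.Gamma b.re := by
    have h := poch_eq_Gamma (z := (b.re : ℂ)) (by simpa using hb) n
    rw [poch_ofReal, ← ofReal_natCast, ← ofReal_add, Gamma_ofReal, Gamma_ofReal] at h
    exact_mod_cast h
  have hbn : 0 < (b + n).re := by simp; positivity
  have h0 := (Real.Gamma_pos_of_pos hb).ne'
  have h1 := norm_Gamma_le hbn
  simp only [add_re, natCast_re] at h1
  rw [poch_eq_Gamma hb, norm_div, hr]
  calc ‖Gamma (b + n)‖ / ‖Gamma b‖ ≤ Real.Gamma (b.re + n) / ‖Gamma b‖ := by gcongr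
    _ = _ := by field_simp

lemma hasSum_gauss {a α b : ℂ} (ha : 0 < a.re) (hb : 0 < b.re) (hαb : 0 < (α - b).re) :
    HasSum (fun n => betaIntegral a α * (kummerCoeff a (a + α) n * poch b n))
      (betaIntegral a (α - b)) := by
  have hα : 0 < α.re := by simp at hαb; linarith
  have h := hasSum_kummerCoeff_mul ha hα (x := poch b)
    (q := fun n => Real.Gamma b.re / ‖Gamma b‖ * (ascPochhammer ℝ n).eval b.re)
    (g := fun u => (1 - (u : ℂ)) ^ (-b))
    (G := fun u => Real.Gamma b.re / ‖Gamma b‖ * (1 - u) ^ (-b.re))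
    (norm_poch_le hb) (fun u hu => hasSum_poch_div_factorial b hu) (fun u hu => ?_) ?_
  · rwa [setIntegral_congr_fun measurableSet_Ioo
      (fun u hu => cpow_neg_mul_betaWeight a α b hu.2), integral_betaWeight] at h
  · have h := hasSum_poch_div_factorial (b.re : ℂ) hu
    have h' : HasSum (fun n : ℕ => (ascPochhammer ℝ n).eval b.re / n.factorial * u ^ n)
        ((1 - u) ^ (-b.re)) := by
      rw [← hasSum_ofReal]
      convert h using 2 with n
      · rw [poch_ofReal]; push_cast; rfl
      · rw [ofReal_cpow (sub_pos.2 hu.2).le]; push_cast; rfl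
    simpa only [mul_assoc, mul_div_assoc] using h'.mul_left (Real.Gamma b.re / ‖Gamma b‖)
  · refine IntegrableOn.congr_fun ((integrableOn_betaWeight ha hαb).norm.const_mul
      (Real.Gamma b.re / ‖Gamma b‖)) (fun u hu => ?_) measurableSet_Ioo
    simp only [mul_assoc, rpow_neg_mul_norm_betaWeight a α b hu.2]

/-! ### The Laplace transform when `0 < re a` -/

/-- The series for `₁F₁(a; c; ·)` and `₂F₁(a, b; c; 1)` converge, and the Laplace transform of
`t ^ (b - 1) * ₁F₁(a; c; s * t)` at `s` converges absolutely to `Γ(b) s ^ (-b) ₂F₁(a, b; c; 1)`. -/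
def KummerLaplace (a b c s : ℂ) : Prop :=
  (∀ z, Summable fun n => kummerCoeff a c n * z ^ n) ∧
  Summable (fun n => kummerCoeff a c n * poch b n) ∧
  IntegrableOn (fun t : ℝ => exp (-(s * t)) * (t : ℂ) ^ (b - 1) * hyp [a] [c] (s * t)) (Ioi 0) ∧
  ∫ t in Ioi (0:ℝ), exp (-(s * t)) * (t : ℂ) ^ (b - 1) * hyp [a] [c] (s * t)
    = Gamma b * s ^ (-b) * hyp [a, b] [c] 1

lemma re_mul_one_sub (s : ℂ) (u : ℝ) : (s * (1 - (u : ℂ))).re = s.re * (1 - u) := by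
  simp

lemma mul_one_sub_cpow {s : ℂ} (hs : s ≠ 0) (b : ℂ) {u : ℝ} (hu : u < 1) :
    (s * (1 - (u : ℂ))) ^ b = s ^ b * (1 - (u : ℂ)) ^ b := by
  have hu' : 0 < 1 - u := sub_pos.2 hu
  have hne : ((1 - u : ℝ) : ℂ) ≠ 0 := by exact_mod_cast hu'.ne'
  rw [← ofReal_one, ← ofReal_sub, cpow_def_of_ne_zero (mul_ne_zero hs hne),
    cpow_def_of_ne_zero hs, cpow_def_of_ne_zero hne, mul_comm s, log_ofReal_mul hu' hs,
    ← exp_add, ofReal_log hu'.le]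
  ring_nf

lemma integrable_laplace_prod {a α b s : ℂ} (ha : 0 < a.re) (hb : 0 < b.re)
    (hαb : 0 < (α - b).re) (hs : 0 < s.re) :
    Integrable (Function.uncurry fun t u : ℝ =>
        exp (-(s * (1 - (u : ℂ)) * t)) * (t : ℂ) ^ (b - 1) * betaWeight a α u)
      ((volume.restrict (Ioi 0)).prod (volume.restrict (Ioo 0 1))) := by
  have hre : ∀ u ∈ Ioo (0:ℝ) 1, 0 < (s * (1 - (u : ℂ))).re := fun u hu => by
    rw [re_mul_one_sub]
    exact mul_pos hs (sub_pos.2 hu.2)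
  have hmeas : Measurable (Function.uncurry fun t u : ℝ =>
      exp (-(s * (1 - (u : ℂ)) * t)) * (t : ℂ) ^ (b - 1) * betaWeight a α u) :=
    Measurable.mul (by fun_prop) ((measurable_betaWeight a α).comp measurable_snd)
  rw [integrable_prod_iff' hmeas.aestronglyMeasurable]
  constructor
  · filter_upwards [ae_restrict_mem measurableSet_Ioo] with u hu
    exact (integrableOn_exp_mul_cpow hb (hre u hu)).mul_const (betaWeight a α u)
  · refine IntegrableOn.congr_fun ((integrableOn_betaWeight ha hαb).norm.const_mul
      (s.re ^ (-b.re) * Real.Gamma b.re)) (fun u hu => ?_) measurableSet_Ioo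
    have hu' : 0 < 1 - u := sub_pos.2 hu.2
    simp only [Function.uncurry_apply_pair]
    rw [setIntegral_congr_fun measurableSet_Ioi (g := fun t =>
      t ^ (b.re - 1) * Real.exp (-((s * (1 - (u : ℂ))).re * t)) * ‖betaWeight a α u‖)
      (fun t ht => by rw [norm_mul, norm_exp_mul_cpow b _ ht]),
      integral_mul_const, Real.integral_rpow_mul_exp_neg_mul_Ioi hb (hre u hu), re_mul_one_sub,
      ← rpow_neg_mul_norm_betaWeight a α b hu.2, one_div, Real.inv_rpow (mul_pos hs hu').le,
      ← Real.rpow_neg (mul_pos hs hu').le, Real.mul_rpow hs.le hu'.le]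
    ring

lemma kummerLaplace_of_re_pos {a α b s : ℂ} (ha : 0 < a.re) (hb : 0 < b.re)
    (hαb : 0 < (α - b).re) (hs : 0 < s.re) : KummerLaplace a b (a + α) s := by
  have hα : 0 < α.re := by simp at hαb; linarith
  have hs0 : s ≠ 0 := by rintro rfl; simp at hs
  have hB : betaIntegral a α ≠ 0 := by
    rw [betaIntegral_eq_div ha hα]
    exact div_ne_zero (mul_ne_zero (Gamma_ne_zero_of_re_pos ha) (Gamma_ne_zero_of_re_pos hα))
      (Gamma_ne_zero_of_re_pos (by simp; linarith))
  have hF := integrable_laplace_prod ha hb hαb hs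
  have hM : ∀ t : ℝ, exp (-(s * t)) * (t : ℂ) ^ (b - 1) * hyp [a] [a + α] (s * t) =
      (betaIntegral a α)⁻¹ * ∫ u in Ioo (0:ℝ) 1,
        exp (-(s * (1 - (u : ℂ)) * t)) * (t : ℂ) ^ (b - 1) * betaWeight a α u := fun t => by
    have h : hyp [a] [a + α] (s * t) =
        (betaIntegral a α)⁻¹ * ∫ u in Ioo (0:ℝ) 1, exp (s * t * u) * betaWeight a α u := by
      rw [← (hasSum_kummer ha hα (s * t)).tsum_eq, tsum_mul_left, inv_mul_cancel_left₀ hB,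
        hyp_kummer]
    rw [h, mul_left_comm, ← integral_const_mul]
    congr 2
    ext u
    rw [show -(s * (1 - (u : ℂ)) * t) = -(s * t) + s * t * u by ring, exp_add]
    ring
  refine ⟨fun z => ?_, ?_, ?_, ?_⟩
  · exact (summable_mul_left_iff hB).1 (hasSum_kummer ha hα z).summable
  · exact (summable_mul_left_iff hB).1 (hasSum_gauss ha hb hαb).summable
  · simp_rw [hM]
    exact hF.integral_prod_left.const_mul _
  · simp_rw [hM]
    rw [integral_const_mul, integral_integral_swap hF, setIntegral_congr_fun measurableSet_Ioo
      (g := fun u => Gamma b * s ^ (-b) * betaWeight a (α - b) u) (fun u hu => ?_),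
      integral_const_mul, integral_betaWeight, ← (hasSum_gauss ha hb hαb).tsum_eq, tsum_mul_left,
      hyp_gauss_one]
    · field_simp
    · have hre : 0 < (s * (1 - (u : ℂ))).re := by
        rw [re_mul_one_sub]
        exact mul_pos hs (sub_pos.2 hu.2)
      change ∫ t in Ioi (0:ℝ), _ = _
      rw [integral_mul_const, laplace_cpow hb hre, mul_one_sub_cpow hs0 _ hu.2,
        mul_assoc, mul_assoc, cpow_neg_mul_betaWeight a α b hu.2, ← mul_assoc]

/-! ### Shifting `a` by a contiguous relation -/

lemma poch_succ_left (a : ℂ) (n : ℕ) : poch a (n + 1) = a * poch (a + 1) n := by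
  simp [poch, ascPochhammer_succ_left]

lemma poch_succ_right (a : ℂ) (n : ℕ) : poch a (n + 1) = poch a n * (a + n) :=
  ascPochhammer_succ_eval n a

lemma poch_ne_zero {c : ℂ} (hc : ∀ n : ℕ, c ≠ -(n : ℂ)) (n : ℕ) : poch c n ≠ 0 := by
  induction n with
  | zero => simp [poch]
  | succ n ih =>
    rw [poch_succ_right]
    exact mul_ne_zero ih fun h => hc n (eq_neg_of_add_eq_zero_left h)

lemma add_one_ne_neg_natCast {c : ℂ} (hc : ∀ n : ℕ, c ≠ -(n : ℂ)) (n : ℕ) :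
    c + 1 ≠ -(n : ℂ) := fun h => hc (n + 1) (by push_cast; linear_combination h)

lemma kummerCoeff_zero (a c : ℂ) : kummerCoeff a c 0 = 1 := by
  simp [kummerCoeff, poch]

lemma kummerCoeff_succ {a c : ℂ} (hc : ∀ n : ℕ, c ≠ -(n : ℂ)) (n : ℕ) :
    kummerCoeff a c (n + 1) = kummerCoeff (a + 1) (c + 1) (n + 1) +
      (a - c) / (c * (c + 1)) * kummerCoeff (a + 1) (c + 1 + 1) n := by
  have hc1 := add_one_ne_neg_natCast hc
  have h0 : c ≠ 0 := by simpa using hc 0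
  have h1 : c + 1 ≠ 0 := by simpa using hc1 0
  have h2 : c + 1 + n ≠ 0 := fun h => hc1 n (eq_neg_of_add_eq_zero_left h)
  have hQ := poch_ne_zero hc1 n
  have hQ2 : poch (c + 1 + 1) n = poch (c + 1) n * (c + 1 + n) / (c + 1) := by
    rw [eq_div_iff h1, ← poch_succ_right, poch_succ_left, mul_comm]
  have hn : (n.factorial : ℂ) ≠ 0 := by exact_mod_cast n.factorial_ne_zero
  have hn1 : (n : ℂ) + 1 ≠ 0 := by exact_mod_cast n.succ_ne_zero
  rw [kummerCoeff, kummerCoeff, kummerCoeff, poch_succ_left a, poch_succ_left c,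
    poch_succ_right (a + 1), poch_succ_right (c + 1), hQ2, Nat.factorial_succ]
  push_cast
  field_simp
  ring

lemma hasSum_kummerCoeff_contiguous {a c A B : ℂ} (hc : ∀ n : ℕ, c ≠ -(n : ℂ)) {x : ℕ → ℂ}
    (hA : HasSum (fun n => kummerCoeff (a + 1) (c + 1) n * x n) A)
    (hB : HasSum (fun n => kummerCoeff (a + 1) (c + 1 + 1) n * x (n + 1)) B) :
    HasSum (fun n => kummerCoeff a c n * x n) (A + (a - c) / (c * (c + 1)) * B) := by
  rw [← hasSum_nat_add_iff' 1] at hA ⊢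
  convert hA.add (hB.mul_left ((a - c) / (c * (c + 1)))) using 1
  · ext n
    rw [kummerCoeff_succ hc]
    ring
  · simp [kummerCoeff_zero]
    ring

lemma KummerLaplace.contiguous {a b c s : ℂ} (hb : b ≠ 0) (hs : s ≠ 0)
    (hc : ∀ n : ℕ, c ≠ -(n : ℂ)) (h₁ : KummerLaplace (a + 1) b (c + 1) s)
    (h₂ : KummerLaplace (a + 1) (b + 1) (c + 1 + 1) s) : KummerLaplace a b c s := by
  obtain ⟨hK₁, hG₁, hI₁, hE₁⟩ := h₁
  obtain ⟨hK₂, hG₂, hI₂, hE₂⟩ := h₂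
  have hK : ∀ z, HasSum (fun n => kummerCoeff a c n * z ^ n)
      (hyp [a + 1] [c + 1] z + (a - c) / (c * (c + 1)) * (z * hyp [a + 1] [c + 1 + 1] z)) := by
    intro z
    refine hasSum_kummerCoeff_contiguous hc ?_ ?_
    · rw [hyp_kummer]
      exact (hK₁ z).hasSum
    · rw [hyp_kummer]
      simpa only [pow_succ', mul_left_comm] using (hK₂ z).hasSum.mul_left z
  have hG : HasSum (fun n => kummerCoeff a c n * poch b n)
      (hyp [a + 1, b] [c + 1] 1 +
        (a - c) / (c * (c + 1)) * (b * hyp [a + 1, b + 1] [c + 1 + 1] 1)) := by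
    refine hasSum_kummerCoeff_contiguous hc ?_ ?_
    · rw [hyp_gauss_one]
      exact hG₁.hasSum
    · rw [hyp_gauss_one]
      simpa only [poch_succ_left, mul_left_comm] using hG₂.hasSum.mul_left b
  have hI : EqOn (fun t : ℝ => exp (-(s * t)) * (t : ℂ) ^ (b - 1) * hyp [a + 1] [c + 1] (s * t) +
      (a - c) / (c * (c + 1)) * s *
        (exp (-(s * t)) * (t : ℂ) ^ (b + 1 - 1) * hyp [a + 1] [c + 1 + 1] (s * t)))
      (fun t : ℝ => exp (-(s * t)) * (t : ℂ) ^ (b - 1) * hyp [a] [c] (s * t)) (Ioi 0) := by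
    intro t ht
    have ht0 : (t : ℂ) ≠ 0 := by exact_mod_cast (ne_of_gt ht)
    have hpow : (t : ℂ) ^ (b + 1 - 1) = (t : ℂ) ^ (b - 1) * t := by
      rw [add_sub_right_comm, cpow_add _ _ ht0, cpow_one]
    simp only
    rw [hyp_kummer a c, (hK _).tsum_eq, hpow]
    ring
  refine ⟨fun z => (hK z).summable, hG.summable, ?_, ?_⟩
  · exact IntegrableOn.congr_fun (hI₁.add (hI₂.const_mul _)) hI measurableSet_Ioi
  · rw [← setIntegral_congr_fun measurableSet_Ioi hI, integral_add hI₁ (hI₂.const_mul _),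
      integral_const_mul, hE₁, hE₂, hyp_gauss_one a b c, hG.tsum_eq, Gamma_add_one b hb,
      neg_add, cpow_add _ _ hs, cpow_neg_one]
    field_simp

lemma kummerLaplace {s : ℂ} (hs : 0 < s.re) (N : ℕ) :
    ∀ a b c : ℂ, 0 < a.re + N → 0 < b.re → 0 < (c - a - b).re → (∀ n : ℕ, c ≠ -(n : ℂ)) →
      KummerLaplace a b c s := by
  induction N with
  | zero =>
    intro a b c ha hb hcab _
    have h := kummerLaplace_of_re_pos (α := c - a) (by simpa using ha) hb hcab hs
    rwa [add_sub_cancel] at h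
  | succ N ih =>
    intro a b c ha hb hcab hc
    have hs0 : s ≠ 0 := by rintro rfl; simp at hs
    have hb0 : b ≠ 0 := by rintro rfl; simp at hb
    have hc1 := add_one_ne_neg_natCast hc
    push_cast at ha
    refine .contiguous hb0 hs0 hc (ih _ _ _ ?_ hb ?_ hc1)
      (ih _ _ _ ?_ ?_ ?_ (add_one_ne_neg_natCast hc1))
    all_goals simp at hcab ⊢; linarith

theorem stmt1 (a b c s : ℂ) (hb : 0 < b.re) (hs : 0 < s.re)
    (hcab : 0 < (c - a - b).re) (hc : (∀ n : ℕ, c ≠ -(n : ℂ))) :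
    ∫ t in Ioi (0:ℝ), Complex.exp (-(s * t)) * (t : ℂ) ^ (b - 1) * hyp [a] [c] (s * t)
      = Complex.Gamma b * s ^ (-b) * hyp [a, b] [c] 1 := by
  obtain ⟨N, hN⟩ := exists_nat_gt (-a.re)
  exact (kummerLaplace hs N a b c (by linarith) hb hcab hc).2.2.2
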